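/- Let p be a prime, d ≥ 1, and w : Z_p^d → [0,∞) with Σ_{x ∈ Z_p^d} w(x) = 1. If B ⊆ Z_p^d is a spectrum for L²(w), then Σ_{m ∈ Z_p^d} w(m)² = 1/|B|. -/

import Mathlib

open Finset

/-- The fixed character `χ(t) = e^{2πi t/p}` of `ℤ/p`. -/
noncomputable def chi (p : ℕ) (t : ZMod p) : ℂ :=
  Complex.exp (2 * Real.pi * Complex.I * (t.val : ℂ) / (p : ℂ))

/-- The dot product on `ℤ_p^d`. -/
def dotp {p d : ℕ} (x y : Fin d → ZMod p) : ZMod p := ∑ i, x i * y i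

/-- The Gabor (time-frequency shifted) function `x ↦ g(x-a) χ(x·b)`. -/
noncomputable def gabor {p d : ℕ} (g : (Fin d → ZMod p) → ℂ) (a b : Fin d → ZMod p) :
    (Fin d → ZMod p) → ℂ :=
  fun x => g (x - a) * chi p (dotp x b)

/-- The inner product of `L²` with counting measure on a finite type. -/
noncomputable def innerC {V : Type*} [Fintype V] (f g : V → ℂ) : ℂ :=
  ∑ x, f x * (starRingEnd ℂ) (g x)

/-- `𝒢(g, A, B)` is an orthonormal basis of `L²(ℤ_p^d)`: the family is orthonormal and
every function is a linear combination of its members. -/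
def IsGaborONB {p d : ℕ} [NeZero p] (g : (Fin d → ZMod p) → ℂ)
    (A B : Finset (Fin d → ZMod p)) : Prop :=
  (∀ a ∈ A, ∀ b ∈ B, ∀ a' ∈ A, ∀ b' ∈ B,
    innerC (gabor g a b) (gabor g a' b') = if a = a' ∧ b = b' then 1 else 0)
  ∧ (∀ f : (Fin d → ZMod p) → ℂ, ∃ c : (Fin d → ZMod p) → (Fin d → ZMod p) → ℂ,
      f = fun x => ∑ a ∈ A, ∑ b ∈ B, c a b * gabor g a b x)

/-- `(E, B)` is a spectral pair: the characters indexed by `B` are pairwise orthogonal in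
`L²(E)` and span it. -/
def IsSpectralPair {p d : ℕ} [NeZero p] (E B : Finset (Fin d → ZMod p)) : Prop :=
  (∀ b ∈ B, ∀ b' ∈ B, b ≠ b' → ∑ x ∈ E, chi p (dotp x (b - b')) = 0)
  ∧ (∀ f : (Fin d → ZMod p) → ℂ, ∃ c : (Fin d → ZMod p) → ℂ,
      ∀ x ∈ E, f x = ∑ b ∈ B, c b * chi p (dotp x b))

/-- `(E, A)` is a tiling pair: `Σ_{a∈A} 1_E(x-a) = 1` for every `x`. -/
def IsTilingPair {p d : ℕ} [NeZero p] (E A : Finset (Fin d → ZMod p)) : Prop :=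
  ∀ x : Fin d → ZMod p, (∑ a ∈ A, if x - a ∈ E then (1 : ℕ) else 0) = 1

/-- The Fourier transform `ĝ(m) = p^{-d} Σ_x χ(-x·m) g(x)` on `ℤ_p^d`. -/
noncomputable def ft {p d : ℕ} [NeZero p] (g : (Fin d → ZMod p) → ℂ)
    (m : Fin d → ZMod p) : ℂ :=
  ((p : ℂ) ^ d)⁻¹ * ∑ x, chi p (-(dotp x m)) * g x

/-- `B` is a spectrum for `L²(w)`: the characters indexed by `B` are pairwise orthogonal
with respect to the weight `w` and every function agrees on the support of `w` with a
linear combination of them. -/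
def IsSpectrumW {p d : ℕ} [NeZero p] (w : (Fin d → ZMod p) → ℝ)
    (B : Finset (Fin d → ZMod p)) : Prop :=
  (∀ b ∈ B, ∀ b' ∈ B, b ≠ b' → ∑ x, chi p (dotp x (b - b')) * (w x : ℂ) = 0)
  ∧ (∀ f : (Fin d → ZMod p) → ℂ, ∃ c : (Fin d → ZMod p) → ℂ,
      ∀ x, w x ≠ 0 → f x = ∑ b ∈ B, c b * chi p (dotp x b))

theorem chi_eq_stdAddChar {p : ℕ} [NeZero p] (t : ZMod p) : chi p t = ZMod.stdAddChar t := by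
  rw [ZMod.stdAddChar_apply, ZMod.toCircle_apply, chi]

theorem chi_dotp_sub {p d : ℕ} [NeZero p] (x b b' : Fin d → ZMod p) :
    chi p (dotp x (b - b')) = chi p (dotp x b) * chi p (-dotp x b') := by
  have h : dotp x (b - b') = dotp x b + -dotp x b' := by
    simp [dotp, mul_sub, ← sub_eq_add_neg]
  rw [h]
  simp only [chi_eq_stdAddChar, AddChar.map_add_eq_mul]

theorem chi_mul_chi_neg {p : ℕ} [NeZero p] (t : ZMod p) : chi p t * chi p (-t) = 1 := by
  simp only [chi_eq_stdAddChar, ← AddChar.map_add_eq_mul, add_neg_cancel, AddChar.map_zero_eq_one]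

/-- The coefficients of a function in terms of a spectrum of a probability weight. -/
theorem IsSpectrumW.coeff_eq {p d : ℕ} [NeZero p] {w : (Fin d → ZMod p) → ℝ}
    {B : Finset (Fin d → ZMod p)} (hB : IsSpectrumW w B) (hw1 : ∑ x, w x = 1)
    {f c : (Fin d → ZMod p) → ℂ}
    (hc : ∀ x, w x ≠ 0 → f x = ∑ b ∈ B, c b * chi p (dotp x b))
    {b : Fin d → ZMod p} (hb : b ∈ B) :
    c b = ∑ x, f x * chi p (-dotp x b) * (w x : ℂ) := by
  have expand : ∀ x, f x * chi p (-dotp x b) * (w x : ℂ) =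
      ∑ b' ∈ B, c b' * (chi p (dotp x (b' - b)) * (w x : ℂ)) := by
    intro x
    by_cases hx : w x = 0
    · simp [hx]
    · rw [hc x hx, Finset.sum_mul, Finset.sum_mul]
      refine Finset.sum_congr rfl fun b' _ => ?_
      rw [chi_dotp_sub]
      ring
  simp_rw [expand]
  rw [Finset.sum_comm]
  simp_rw [← Finset.mul_sum]
  rw [Finset.sum_eq_single_of_mem b hb fun b' hb' hne => by rw [hB.1 b' hb' b hb hne, mul_zero]]
  simp only [chi_dotp_sub, chi_mul_chi_neg, one_mul]
  rw [← Complex.ofReal_sum, hw1, Complex.ofReal_one, mul_one]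

/-- A probability weight with spectrum `B` is constant, equal to `1/|B|`, on its support. -/
theorem IsSpectrumW.weight_mul_card {p d : ℕ} [NeZero p] {w : (Fin d → ZMod p) → ℝ}
    {B : Finset (Fin d → ZMod p)} (hB : IsSpectrumW w B) (hw1 : ∑ x, w x = 1)
    {x : Fin d → ZMod p} (hx : w x ≠ 0) : w x * (B.card : ℝ) = 1 := by
  obtain ⟨c, hc⟩ := hB.2 (Pi.single x 1)
  have hcb : ∀ b ∈ B, c b * chi p (dotp x b) = (w x : ℂ) := by
    intro b hb
    rw [hB.coeff_eq hw1 hc hb, Finset.sum_eq_single x (fun y _ hy => by simp [hy]) (by simp),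
      Pi.single_eq_same, one_mul, mul_right_comm, mul_comm (chi p _), chi_mul_chi_neg, one_mul]
  have h := hc x hx
  rw [Pi.single_eq_same, Finset.sum_congr rfl hcb, Finset.sum_const, nsmul_eq_mul, mul_comm] at h
  exact_mod_cast h.symm

/-- If `w ≥ 0`, `Σ_x w(x) = 1` and `B` is a spectrum for `L²(w)`,
then `Σ_m w(m)² = 1/|B|`. -/
theorem sum_sq_weight_of_spectrum
    (p : ℕ) [Fact p.Prime] (d : ℕ) (hd : 1 ≤ d)
    (w : (Fin d → ZMod p) → ℝ) (hw : ∀ x, 0 ≤ w x) (hw1 : ∑ x, w x = 1)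
    (B : Finset (Fin d → ZMod p)) (hB : IsSpectrumW w B) :
    ∑ m, w m ^ 2 = (B.card : ℝ)⁻¹ := by
  refine eq_inv_of_mul_eq_one_left ?_
  rw [Finset.sum_mul, ← hw1]
  refine Finset.sum_congr rfl fun x _ => ?_
  by_cases hx : w x = 0
  · simp [hx]
  · rw [sq, mul_assoc, hB.weight_mul_card hw1 hx, mul_one]
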